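/- Fix m ≥ 0, c ∈ [0,1] and k ∈ ℝ. For ε ∈ (0,1) define θ(ε) = arccos(c·ε), ζ(ε) = m·ε·cos(π ε)/sin(θ(ε)), and W(ε) = G(c,−ε) ⬝ S(k) ⬝ C(θ(ε),−ζ(ε)) ⬝ S(k) ⬝ C(θ(ε),ζ(ε)) ⬝ G(c,ε). Then as ε → 0⁺, (W(ε) − I)/(2ε) converges to −i·H_L(k), where H_L(k) = (c/2)·(sin(2k)·σx + (cos(2k) − 1)·σy) − m·σz is the momentum-space lattice-fermion Hamiltonian. This is the continuous-time discrete-space limit of the Plastic quantum walk. -/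

import Mathlib

open Matrix Complex Filter

/-- Pauli matrix σx. -/
def sigmaX : Matrix (Fin 2) (Fin 2) ℂ := !![0, 1; 1, 0]

/-- Pauli matrix σy. -/
def sigmaY : Matrix (Fin 2) (Fin 2) ℂ := !![0, -Complex.I; Complex.I, 0]

/-- Pauli matrix σz. -/
def sigmaZ : Matrix (Fin 2) (Fin 2) ℂ := !![1, 0; 0, -1]

/-- The coin operator of the Plastic quantum walk. -/
noncomputable def coinC (θ ζ : ℝ) : Matrix (Fin 2) (Fin 2) ℂ :=
  !![-(Real.cos θ : ℂ), Complex.exp (-Complex.I * ζ) * Real.sin θ;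
     Complex.exp (Complex.I * ζ) * Real.sin θ, (Real.cos θ : ℂ)]

/-- S(k) = [[e^{ik},0],[0,e^{−ik}]]. -/
noncomputable def Smat (k : ℝ) : Matrix (Fin 2) (Fin 2) ℂ :=
  !![Complex.exp (Complex.I * k), 0; 0, Complex.exp (-Complex.I * k)]

/-- f⁺ = √(1−c) + √(1+c). -/
noncomputable def fplus (c : ℝ) : ℝ := Real.sqrt (1 - c) + Real.sqrt (1 + c)

/-- f⁻ = √(1−c) − √(1+c). -/
noncomputable def fminus (c : ℝ) : ℝ := Real.sqrt (1 - c) - Real.sqrt (1 + c)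

/-- Λ(c) = (1/2)[[−f⁻, f⁺],[f⁺, f⁻]]. -/
noncomputable def Lam (c : ℝ) : Matrix (Fin 2) (Fin 2) ℂ :=
  (1 / 2 : ℂ) • !![-(fminus c : ℂ), (fplus c : ℂ); (fplus c : ℂ), (fminus c : ℂ)]

/-- G(c,κ) = ((1+e^{iπκ})/2)·I + ((1−e^{iπκ})/2)·Λ(c). -/
noncomputable def Gmat (c κ : ℝ) : Matrix (Fin 2) (Fin 2) ℂ :=
  ((1 + Complex.exp (Complex.I * Real.pi * κ)) / 2) • (1 : Matrix (Fin 2) (Fin 2) ℂ) +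
    ((1 - Complex.exp (Complex.I * Real.pi * κ)) / 2) • Lam c

/-- θ(ε) = arccos(c·ε), the α = 1 scaling. -/
noncomputable def thetaF (c ε : ℝ) : ℝ := Real.arccos (c * ε)

/-- ζ(ε) = m·ε·cos(π ε)/sin(θ(ε)). -/
noncomputable def zetaF (m c ε : ℝ) : ℝ := m * ε * Real.cos (Real.pi * ε) / Real.sin (thetaF c ε)

/-- The momentum-space walk operator in the α = 1 scaling (fixed lattice momentum k). -/
noncomputable def Wop (m c k ε : ℝ) : Matrix (Fin 2) (Fin 2) ℂ :=
  Gmat c (-ε) * Smat k * coinC (thetaF c ε) (-(zetaF m c ε)) *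
    Smat k * coinC (thetaF c ε) (zetaF m c ε) * Gmat c ε

/-- The momentum-space lattice-fermion Hamiltonian
H_L(k) = (c/2)(sin(2k)σx + (cos(2k)−1)σy) − mσz. -/
noncomputable def HL (m c k : ℝ) : Matrix (Fin 2) (Fin 2) ℂ :=
  ((c : ℂ) / 2) • ((Real.sin (2 * k) : ℂ) • sigmaX + ((Real.cos (2 * k) : ℂ) - 1) • sigmaY)
    - (m : ℂ) • sigmaZ


/-- Entrywise value and derivative at zero. -/
def MD (A : ℝ → Matrix (Fin 2) (Fin 2) ℂ) (A0 A' : Matrix (Fin 2) (Fin 2) ℂ) : Prop :=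
  A 0 = A0 ∧ ∀ i j, HasDerivAt (fun x => A x i j) (A' i j) 0

lemma MD.mul {A B : ℝ → Matrix (Fin 2) (Fin 2) ℂ} {A0 A' B0 B' : Matrix (Fin 2) (Fin 2) ℂ}
    (hA : MD A A0 A') (hB : MD B B0 B') :
    MD (fun x => A x * B x) (A0 * B0) (A' * B0 + A0 * B') := by
  refine ⟨by simp [hA.1, hB.1], fun i j => ?_⟩
  have := ((hA.2 i 0).mul (hB.2 0 j)).add ((hA.2 i 1).mul (hB.2 1 j))
  simp only [hA.1, hB.1] at this
  refine (this.congr_deriv ?_).congr_of_eventuallyEq (Filter.Eventually.of_forall fun x => ?_)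
  · simp [Matrix.mul_apply, Fin.sum_univ_two]; ring
  · simp [Matrix.mul_apply, Fin.sum_univ_two]

lemma MD.const (A : Matrix (Fin 2) (Fin 2) ℂ) : MD (fun _ => A) A 0 :=
  ⟨rfl, fun i j => by simpa using hasDerivAt_const (0:ℝ) (A i j)⟩

lemma expD {f : ℝ → ℝ} {f' : ℝ} (hf : HasDerivAt f f' 0) (h0 : f 0 = 0) (a : ℂ) :
    HasDerivAt (fun x => Complex.exp (a * (f x : ℂ))) (a * f') 0 := by
  have := ((hf.ofReal_comp).const_mul a).cexp
  simpa [h0] using this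

lemma MD_G (c s : ℝ) : MD (fun x => Gmat c (s * x)) 1
    ((s : ℂ) • ((Complex.I * Real.pi / 2) • (1 - Lam c))) := by
  refine ⟨by simp [Gmat], fun i j => ?_⟩
  have h := expD (f := fun x => s * x) (f' := s)
    (by simpa using (hasDerivAt_id (0:ℝ)).const_mul s) (by simp) (Complex.I * Real.pi)
  have := (((h.const_add 1).div_const 2).mul_const ((1 : Matrix (Fin 2) (Fin 2) ℂ) i j)).add
    (((h.const_sub 1).div_const 2).mul_const (Lam c i j))
  refine (this.congr_deriv ?_).congr_of_eventuallyEq (Filter.Eventually.of_forall fun x => ?_)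
  · simp; ring
  · simp [Gmat]

lemma sinD (c : ℝ) : HasDerivAt (fun x => Real.sin (thetaF c x)) 0 0 := by
  have h1 : HasDerivAt (fun x : ℝ => 1 - (c * x) ^ 2) 0 0 := by
    have := ((((hasDerivAt_id (0:ℝ)).const_mul c).pow 2).const_sub 1)
    simpa using this
  have := h1.sqrt (by simp)
  simpa [thetaF, Real.sin_arccos] using this

lemma cosD (c : ℝ) : HasDerivAt (fun x => Real.cos (thetaF c x)) c 0 := by
  have h : HasDerivAt (fun x : ℝ => Real.arccos (c * x)) (-c) 0 := by
    have h0 : HasDerivAt (fun x : ℝ => c * x) c 0 := by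
      simpa using (hasDerivAt_id (0:ℝ)).const_mul c
    have := HasDerivAt.comp (0:ℝ) (h₂ := Real.arccos)
      (Real.hasDerivAt_arccos (x := c * 0) (by simp) (by simp)) h0
    simpa [Function.comp_def] using this
  simpa [thetaF] using h.cos

lemma zetaD (m c : ℝ) : HasDerivAt (fun x => zetaF m c x) m 0 := by
  have h1 : HasDerivAt (fun x : ℝ => m * x) m 0 := by
    simpa using (hasDerivAt_id (0:ℝ)).const_mul m
  have h2 : HasDerivAt (fun x : ℝ => Real.cos (Real.pi * x)) 0 0 := by
    simpa using ((hasDerivAt_id (0:ℝ)).const_mul Real.pi).cos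
  have := (h1.mul h2).div (sinD c) (by simp [thetaF])
  refine (this.congr_deriv ?_).congr_of_eventuallyEq (Filter.Eventually.of_forall fun x => ?_)
  · simp [thetaF]
  · simp [zetaF]

lemma MD_C (m c s : ℝ) : MD (fun x => coinC (thetaF c x) (s * zetaF m c x)) !![0, 1; 1, 0]
    !![-(c : ℂ), -Complex.I * (s * m); Complex.I * (s * m), c] := by
  have hz : zetaF m c 0 = 0 := by simp [zetaF]
  have ht : thetaF c 0 = Real.pi / 2 := by simp [thetaF]
  have hs := (sinD c).ofReal_comp
  have hcs := (cosD c).ofReal_comp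
  have he := fun a => expD ((zetaD m c).const_mul s) (by simp [hz]) a
  refine ⟨by simp [coinC, hz, ht], fun i j => ?_⟩
  fin_cases i <;> fin_cases j
  · simpa [coinC, Pi.neg_def] using hcs.neg
  · have := (he (-Complex.I)).mul hs
    simpa [coinC, hz, ht, Pi.mul_def] using this
  · have := (he (Complex.I)).mul hs
    simpa [coinC, hz, ht, Pi.mul_def] using this
  · simpa [coinC] using hcs

theorem plasticQW_continuous_time_discrete_space_limit (m c k : ℝ)
    (hm : 0 ≤ m) (hc : c ∈ Set.Icc (0 : ℝ) 1) :
    Tendsto (fun ε : ℝ => (2 * (ε : ℂ))⁻¹ • (Wop m c k ε - 1))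
      (nhdsWithin 0 (Set.Ioi 0))
      (nhds ((-Complex.I) • HL m c k)) := by
  have H := (((((MD_G c (-1)).mul (MD.const (Smat k))).mul (MD_C m c (-1))).mul
    (MD.const (Smat k))).mul (MD_C m c 1)).mul (MD_G c 1)
  have hE : Complex.exp (Complex.I * k) * Complex.exp (-(Complex.I * k)) = 1 := by
    rw [← Complex.exp_add]; simp
  have h1 : Complex.exp (Complex.I * k) = Complex.cos k + Complex.sin k * Complex.I := by
    rw [mul_comm, Complex.exp_mul_I]
  have h2 : Complex.exp (-(Complex.I * k)) = Complex.cos k - Complex.sin k * Complex.I := by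
    rw [show -(Complex.I * (k:ℂ)) = (-(k:ℂ)) * Complex.I by ring, Complex.exp_mul_I]
    simp; ring
  have h3 := Complex.sin_sq_add_cos_sq (k : ℂ)
  have hI := Complex.I_mul_I
  have W0 : Wop m c k 0 = 1 := by
    have := H.1
    have e : (1 : Matrix (Fin 2) (Fin 2) ℂ) * Smat k * !![0, 1; 1, 0] * Smat k * !![0, 1; 1, 0] * 1
        = 1 := by
      ext i j
      fin_cases i <;> fin_cases j <;> simp [Smat, Matrix.mul_apply, Fin.sum_univ_two, hE]
      rw [mul_comm, hE]
    rw [e] at this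
    rw [← this]; simp [Wop]
  refine tendsto_pi_nhds.2 fun i => tendsto_pi_nhds.2 fun j => ?_
  have hd := H.2 i j
  have hd2 : HasDerivAt (fun x => Wop m c k x i j) (2 * ((-Complex.I) • HL m c k) i j) 0 := by
    refine (hd.congr_deriv ?_).congr_of_eventuallyEq (Filter.Eventually.of_forall fun x => ?_)
    · clear hd H
      generalize Lam c = L
      fin_cases i <;> fin_cases j <;>
        simp [Smat, HL, sigmaX, sigmaY, sigmaZ, Matrix.mul_apply, Fin.sum_univ_two, Matrix.vecMul, dotProduct,
          Complex.sin_two_mul, Complex.cos_two_mul, h1, h2] <;>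
        generalize Complex.cos (k:ℂ) = C at * <;>
        generalize Complex.sin (k:ℂ) = S at * <;> 
        grind
    · simp [Wop]
  have ht := (hd2.tendsto_slope_zero_right).const_mul (1/2 : ℂ)
  have e2 : (1/2 : ℂ) * (2 * ((-Complex.I) • HL m c k) i j) = ((-Complex.I) • HL m c k) i j := by
    ring
  rw [e2] at ht
  refine ht.congr fun x => ?_
  simp [W0]
  ring
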